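/- arXiv:2605.21059 — 2 statements merged into one kernel-verified Lean document; each statement's English description precedes it below -/
import Mathlib

section
/- Let p, q ∈ ℕ and let ι be a finite index set; for each j ∈ ι fix natural numbers w_j and D_j. Let h : ℝ^p × ℝ^q → ℝ^p be differentiable at a point z₀ ∈ ℝ^p × ℝ^q. For each j ∈ ι, let K_j : ℝ^p × ℝ^q → ℝ^{w_j} be differentiable at z₀ with fderiv K_j z₀ (0, v) = 0 for all v ∈ ℝ^q, let F_j : ℝ^p × ℝ^{w_j} → ℝ^{D_j} be differentiable at (h(z₀), K_j(z₀)), and assume the composite map z ↦ F_j(h(z), K_j(z)) has Fréchet derivative at z₀ satisfying fderiv (F_j ∘ (h, K_j)) z₀ (0, v) = 0 for all v ∈ ℝ^q. Define the continuous linear map A_j : ℝ^p → ℝ^{D_j} by A_j(u) := fderiv F_j (h(z₀), K_j(z₀)) (u, 0), and assume there exist continuous linear maps L_j : ℝ^{D_j} → ℝ^p with ∑_{j ∈ ι} L_j ∘ A_j = id_{ℝ^p}. Then fderiv h z₀ (0, v) = 0 for every v ∈ ℝ^q. -/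
/-- Deterministic core of Theorem 1 (Subspace Identifiability with Pairwise Modalities):
if for every neighbor `j` the composite `z ↦ F j (h z, K j z)` and `K j` have vanishing
derivative in the second coordinate block at `z₀`, and the partial Jacobians
`A j : u ↦ fderiv (F j) (h z₀, K j z₀) (u, 0)` admit left coefficients `L j` with
`∑ j, L j ∘ A j = id`, then `fderiv h z₀ (0, v) = 0` for all `v`. -/
theorem stmt_4 (p q : ℕ) {ι : Type*} [Fintype ι] (w D : ι → ℕ)
    (h : EuclideanSpace ℝ (Fin p) × EuclideanSpace ℝ (Fin q) → EuclideanSpace ℝ (Fin p))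
    (z₀ : EuclideanSpace ℝ (Fin p) × EuclideanSpace ℝ (Fin q))
    (hh : DifferentiableAt ℝ h z₀)
    (K : ∀ j : ι, EuclideanSpace ℝ (Fin p) × EuclideanSpace ℝ (Fin q) →
      EuclideanSpace ℝ (Fin (w j)))
    (hK : ∀ j : ι, DifferentiableAt ℝ (K j) z₀)
    (hKv : ∀ j : ι, ∀ v : EuclideanSpace ℝ (Fin q), fderiv ℝ (K j) z₀ (0, v) = 0)
    (F : ∀ j : ι, EuclideanSpace ℝ (Fin p) × EuclideanSpace ℝ (Fin (w j)) →
      EuclideanSpace ℝ (Fin (D j)))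
    (hF : ∀ j : ι, DifferentiableAt ℝ (F j) (h z₀, K j z₀))
    (hcomp : ∀ j : ι, ∀ v : EuclideanSpace ℝ (Fin q),
      fderiv ℝ (fun z => F j (h z, K j z)) z₀ (0, v) = 0)
    (L : ∀ j : ι, EuclideanSpace ℝ (Fin (D j)) →L[ℝ] EuclideanSpace ℝ (Fin p))
    (hL : ∑ j : ι, (L j).comp
        ((fderiv ℝ (F j) (h z₀, K j z₀)).comp
          (ContinuousLinearMap.inl ℝ (EuclideanSpace ℝ (Fin p))
            (EuclideanSpace ℝ (Fin (w j)))))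
      = ContinuousLinearMap.id ℝ (EuclideanSpace ℝ (Fin p))) :
    ∀ v : EuclideanSpace ℝ (Fin q), fderiv ℝ h z₀ (0, v) = 0 := by
  intro v
  have key : ∀ j, fderiv ℝ (F j) (h z₀, K j z₀) (fderiv ℝ h z₀ (0, v), 0) = 0 := by
    intro j
    have h1 : HasFDerivAt (fun z => F j (h z, K j z))
        ((fderiv ℝ (F j) (h z₀, K j z₀)).comp
          ((fderiv ℝ h z₀).prod (fderiv ℝ (K j) z₀))) z₀ :=
      HasFDerivAt.comp (f := fun z => (h z, K j z)) z₀ (hF j).hasFDerivAt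
        (hh.hasFDerivAt.prodMk (hK j).hasFDerivAt)
    have h2 := hcomp j v
    rw [h1.fderiv, ContinuousLinearMap.comp_apply, ContinuousLinearMap.prod_apply, hKv j v] at h2
    exact h2
  have h3 := congrArg (fun T => T (fderiv ℝ h z₀ (0, v))) hL
  simp only [ContinuousLinearMap.sum_apply, ContinuousLinearMap.comp_apply,
    ContinuousLinearMap.inl_apply, key, map_zero, Finset.sum_const_zero,
    ContinuousLinearMap.id_apply] at h3
  exact h3.symm
end

section
/- Let p, q ∈ ℕ and let h : ℝ^p × ℝ^q → ℝ^p × ℝ^q be a bijection such that both h and its inverse h⁻¹ are differentiable everywhere. Suppose there exist a differentiable map φ : ℝ^p → ℝ^p and a map ψ : ℝ^p × ℝ^q → ℝ^q such that h(x, y) = (φ(x), ψ(x, y)) for all (x, y) ∈ ℝ^p × ℝ^q. Then for every x ∈ ℝ^p, the Fréchet derivative fderiv φ x : ℝ^p → ℝ^p is a linear bijection. -/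
/-- Invertibility step in the proof of Theorem 1: if `h : ℝ^p × ℝ^q → ℝ^p × ℝ^q` is a
bijection with everywhere-differentiable inverse, and `h (x, y) = (φ x, ψ (x, y))` with `φ`
differentiable, then `fderiv φ x` is a linear bijection for every `x`. -/
theorem stmt_7 (p q : ℕ)
    (h h' : EuclideanSpace ℝ (Fin p) × EuclideanSpace ℝ (Fin q) →
      EuclideanSpace ℝ (Fin p) × EuclideanSpace ℝ (Fin q))
    (hli : Function.LeftInverse h' h) (hri : Function.RightInverse h' h)
    (hd : Differentiable ℝ h) (hd' : Differentiable ℝ h')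
    (φ : EuclideanSpace ℝ (Fin p) → EuclideanSpace ℝ (Fin p))
    (ψ : EuclideanSpace ℝ (Fin p) × EuclideanSpace ℝ (Fin q) → EuclideanSpace ℝ (Fin q))
    (hφ : Differentiable ℝ φ)
    (hform : ∀ (x : EuclideanSpace ℝ (Fin p)) (y : EuclideanSpace ℝ (Fin q)),
      h (x, y) = (φ x, ψ (x, y))) :
    ∀ x : EuclideanSpace ℝ (Fin p), Function.Bijective (fderiv ℝ φ x) := by
  intro x
  have key : ∀ z, φ (h' z).1 = z.1 := by
    intro z
    have h1 := hform (h' z).1 (h' z).2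
    rw [Prod.mk.eta, hri z] at h1
    exact (congrArg Prod.fst h1).symm
  have hx : h' (φ x, ψ (x, 0)) = (x, 0) := by
    rw [← hform x 0]
    exact hli (x, 0)
  have h1 : HasFDerivAt φ (fderiv ℝ φ x) (h' (φ x, ψ (x, 0))).1 := by
    rw [hx]
    exact (hφ x).hasFDerivAt
  have h2 := h1.comp (φ x, ψ (x, 0)) (hd' (φ x, ψ (x, 0))).hasFDerivAt.fst
  have h3 : (φ ∘ fun z => (h' z).1) = Prod.fst := funext key
  rw [h3] at h2
  have h4 := h2.unique hasFDerivAt_fst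
  have hsurj : Function.Surjective (fderiv ℝ φ x) := by
    intro v
    have h5 := DFunLike.congr_fun h4 (v, 0)
    exact ⟨_, h5⟩
  have hinj : Function.Injective (fderiv ℝ φ x) :=
    (LinearMap.injective_iff_surjective
      (f := (fderiv ℝ φ x : EuclideanSpace ℝ (Fin p) →ₗ[ℝ] EuclideanSpace ℝ (Fin p)))).2 hsurj
  exact ⟨hinj, hsurj⟩
end
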